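/- arXiv:2602.16794 — 2 statements merged into one kernel-verified Lean document; each statement's English description precedes it below -/
import Mathlib

section
/- Let Y be a finite nonempty type, K ≥ 1, and h : Y → Fin K a clustering map such that every cluster Y_k := {y : h y = k} has positive mass under both probability vectors p_a and p_b (i.e. ∑_{y ∈ Y_k} p_a y > 0 and ∑_{y ∈ Y_k} p_b y > 0 for every k). Let r_a, r_b : Y → ℝ. For each cluster k define μ_{k} := (∑_{y ∈ Y_k} p_a y · r_a y) / (∑_{y ∈ Y_k} p_a y) and ε_{k} := max_{y ∈ Y_k} r_a y − min_{y ∈ Y_k} r_a y. Then the disparity Δ := |∑_{y ∈ Y} p_a y · r_a y − ∑_{y ∈ Y} p_b y · r_b y| satisfies Δ ≤ max_{k} ε_{k} + (max_{k} μ_{k} − min_{k} μ_{k}) + |∑_{y ∈ Y} p_b y · (r_a y − r_b y)|. -/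
open Finset

/-- A weighted sum of values lying in the interval `[l, u]` lies between the
corresponding multiples of the total weight. -/
theorem sum_mul_mem_Icc_of_mem_Icc {ι : Type*} (s : Finset ι) {w f : ι → ℝ} {l u : ℝ}
    (hw : ∀ i ∈ s, 0 ≤ w i) (hf : ∀ i ∈ s, f i ∈ Set.Icc l u) :
    ∑ i ∈ s, w i * f i ∈ Set.Icc ((∑ i ∈ s, w i) * l) ((∑ i ∈ s, w i) * u) := by
  rw [sum_mul, sum_mul]
  exact ⟨sum_le_sum fun i hi => mul_le_mul_of_nonneg_left (hf i hi).1 (hw i hi),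
    sum_le_sum fun i hi => mul_le_mul_of_nonneg_left (hf i hi).2 (hw i hi)⟩

/-- **Theorem 3.1 (Label-Clustered CP set size disparity bound), discrete form.**
The disparity between the two groups' weighted sums is bounded by the maximum
intra-cluster spread, plus the cross-cluster spread of the cluster-conditional
means, plus the intra-label cross-group disparity term. -/
theorem label_clustered_set_size_disparity_bound
    {Y : Type*} [Fintype Y] [Nonempty Y] {K : ℕ} (hK : 1 ≤ K)
    (h : Y → Fin K) (pa pb : Y → ℝ)
    (hpa0 : ∀ y, 0 ≤ pa y) (hpa1 : ∑ y, pa y = 1)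
    (hpb0 : ∀ y, 0 ≤ pb y) (hpb1 : ∑ y, pb y = 1)
    (hmass_a : ∀ k : Fin K, 0 < ∑ y ∈ univ.filter (fun y => h y = k), pa y)
    (hmass_b : ∀ k : Fin K, 0 < ∑ y ∈ univ.filter (fun y => h y = k), pb y)
    (ra rb : Y → ℝ)
    (μ : Fin K → ℝ)
    (hμ : ∀ k, μ k = (∑ y ∈ univ.filter (fun y => h y = k), pa y * ra y) /
          (∑ y ∈ univ.filter (fun y => h y = k), pa y))
    (ε : Fin K → ℝ)
    (hε : ∀ k, ε k = (⨆ y : {y : Y // h y = k}, ra y.1) -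
          ⨅ y : {y : Y // h y = k}, ra y.1) :
    |∑ y, pa y * ra y - ∑ y, pb y * rb y| ≤
      (⨆ k, ε k) + ((⨆ k, μ k) - ⨅ k, μ k) + |∑ y, pb y * (ra y - rb y)| := by
  have hr : ∀ y, ra y ∈ Set.Icc (⨅ z : {z : Y // h z = h y}, ra z.1)
      (⨆ z : {z : Y // h z = h y}, ra z.1) := fun y =>
    ⟨ciInf_le (f := fun z : {z : Y // h z = h y} => ra z.1) (Set.finite_range _).bddBelow ⟨y, rfl⟩,
      le_ciSup (f := fun z : {z : Y // h z = h y} => ra z.1) (Set.finite_range _).bddAbove ⟨y, rfl⟩⟩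
  have hmean : ∀ k, μ k ∈ Set.Icc (⨅ z : {z : Y // h z = k}, ra z.1)
      (⨆ z : {z : Y // h z = k}, ra z.1) := by
    intro k
    have hsum := sum_mul_mem_Icc_of_mem_Icc (univ.filter fun y => h y = k) (w := pa) (f := ra)
      (l := ⨅ z : {z : Y // h z = k}, ra z.1) (u := ⨆ z : {z : Y // h z = k}, ra z.1)
      (fun y _ => hpa0 y) (fun y hy => by
        obtain rfl := (mem_filter.1 hy).2
        exact hr y)
    rw [hμ k]
    exact ⟨(le_div_iff₀' (hmass_a k)).2 hsum.1, (div_le_iff₀' (hmass_a k)).2 hsum.2⟩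
  have hdev : ∀ y, ra y - μ (h y) ∈ Set.Icc (-⨆ k, ε k) (⨆ k, ε k) := by
    intro y
    have hle : ε (h y) ≤ ⨆ k, ε k := le_ciSup (Set.finite_range ε).bddAbove (h y)
    rw [hε] at hle
    obtain ⟨h1, h2⟩ := hr y
    obtain ⟨h3, h4⟩ := hmean (h y)
    constructor <;> linarith
  have hμb : ∀ y, μ (h y) ∈ Set.Icc (⨅ k, μ k) (⨆ k, μ k) := fun y =>
    ⟨ciInf_le (Set.finite_range μ).bddBelow (h y), le_ciSup (Set.finite_range μ).bddAbove (h y)⟩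
  have htower : ∑ y, pa y * ra y = ∑ y, pa y * μ (h y) := by
    rw [← sum_fiberwise univ h, ← sum_fiberwise univ h (fun y => pa y * μ (h y))]
    refine sum_congr rfl fun k _ => ?_
    have hconst : ∑ y ∈ univ.filter (fun y => h y = k), pa y * μ (h y) =
        (∑ y ∈ univ.filter (fun y => h y = k), pa y) * μ k := by
      rw [sum_mul]
      exact sum_congr rfl fun y hy => by rw [(mem_filter.1 hy).2]
    rw [hconst, hμ k, mul_div_cancel₀ _ (hmass_a k).ne']
  have ha := sum_mul_mem_Icc_of_mem_Icc univ (fun y _ => hpa0 y) (fun y _ => hμb y)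
  have hb := sum_mul_mem_Icc_of_mem_Icc univ (fun y _ => hpb0 y) (fun y _ => hμb y)
  have hd := sum_mul_mem_Icc_of_mem_Icc univ (fun y _ => hpb0 y) (fun y _ => hdev y)
  simp only [hpa1, hpb1, one_mul, mul_sub, sum_sub_distrib, Set.mem_Icc] at ha hb hd ⊢
  rw [← htower] at ha
  have hab : |∑ y, pa y * ra y - ∑ y, pb y * ra y| ≤
      (⨆ k, ε k) + ((⨆ k, μ k) - ⨅ k, μ k) :=
    abs_le.2 ⟨by linarith, by linarith⟩
  exact (abs_sub_le _ (∑ y, pb y * ra y) _).trans (by gcongr)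
end

section
/- Let Y be a finite nonempty type, h : Y → Fin K a clustering map, and p_a, p_b probability vectors on Y such that every cluster has positive mass under both, i.e. P_a(k) := ∑_{y ∈ Y_k} p_a y > 0 and P_b(k) := ∑_{y ∈ Y_k} p_b y > 0 for every k, where Y_k := {y : h y = k}. Define within-cluster weights w_a(y) := p_a y / P_a(h y) and w_b(y) := p_b y / P_b(h y). Then for every r : Y → ℝ, |∑_{k} P_a(k) · ∑_{y ∈ Y_k} (w_a(y) − w_b(y)) · r y| ≤ max_{k} ε_k, where ε_k := max_{y ∈ Y_k} r y − min_{y ∈ Y_k} r y. -/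
open Finset

/-- Two weighted averages of values in `[m, M]` differ by at most `M - m`. -/
theorem abs_sum_sub_mul_le_sub {ι : Type*} {s : Finset ι} {u v r : ι → ℝ} {m M : ℝ}
    (hu0 : ∀ i ∈ s, 0 ≤ u i) (hu1 : ∑ i ∈ s, u i = 1)
    (hv0 : ∀ i ∈ s, 0 ≤ v i) (hv1 : ∑ i ∈ s, v i = 1)
    (hm : ∀ i ∈ s, m ≤ r i) (hM : ∀ i ∈ s, r i ≤ M) :
    |∑ i ∈ s, (u i - v i) * r i| ≤ M - m := by
  have upper {w : ι → ℝ} (h0 : ∀ i ∈ s, 0 ≤ w i) (h1 : ∑ i ∈ s, w i = 1) :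
      ∑ i ∈ s, w i * r i ≤ M := by
    calc ∑ i ∈ s, w i * r i ≤ ∑ i ∈ s, w i * M :=
          sum_le_sum fun i hi => mul_le_mul_of_nonneg_left (hM i hi) (h0 i hi)
      _ = M := by rw [← sum_mul, h1, one_mul]
  have lower {w : ι → ℝ} (h0 : ∀ i ∈ s, 0 ≤ w i) (h1 : ∑ i ∈ s, w i = 1) :
      m ≤ ∑ i ∈ s, w i * r i := by
    calc m = ∑ i ∈ s, w i * m := by rw [← sum_mul, h1, one_mul]
      _ ≤ ∑ i ∈ s, w i * r i :=
          sum_le_sum fun i hi => mul_le_mul_of_nonneg_left (hm i hi) (h0 i hi)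
  simp only [sub_mul, sum_sub_distrib]
  rw [abs_le]
  constructor <;> linarith [upper hu0 hu1, upper hv0 hv1, lower hu0 hu1, lower hv0 hv1]

/-- Weights normalized by the mass of their cluster sum to one on each cluster. -/
theorem sum_fiber_div_mass_eq_one {Y κ : Type*} [Fintype Y] [DecidableEq κ] {h : Y → κ}
    {p w : Y → ℝ} {P : κ → ℝ} {k : κ}
    (hP : P k = ∑ y ∈ univ.filter (fun y => h y = k), p y) (hP0 : P k ≠ 0)
    (hw : ∀ y, w y = p y / P (h y)) :
    ∑ y ∈ univ.filter (fun y => h y = k), w y = 1 := by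
  have hcongr : ∑ y ∈ univ.filter (fun y => h y = k), w y =
      ∑ y ∈ univ.filter (fun y => h y = k), p y / P k :=
    sum_congr rfl fun y hy => by rw [hw, (mem_filter.mp hy).2]
  rw [hcongr, ← sum_div, ← hP, div_self hP0]

/-- The bound on term (I)₁ in the proof of Theorem 3.1: the within-cluster
contribution to set size disparity is controlled by the maximum intra-cluster
spread. -/
theorem within_cluster_term_le_max_spread
    {Y : Type*} [Fintype Y] [Nonempty Y] {K : ℕ}
    (h : Y → Fin K) (pa pb : Y → ℝ)
    (hpa0 : ∀ y, 0 ≤ pa y) (hpa1 : ∑ y, pa y = 1)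
    (hpb0 : ∀ y, 0 ≤ pb y) (hpb1 : ∑ y, pb y = 1)
    (Pa Pb : Fin K → ℝ)
    (hPa : ∀ k, Pa k = ∑ y ∈ univ.filter (fun y => h y = k), pa y)
    (hPb : ∀ k, Pb k = ∑ y ∈ univ.filter (fun y => h y = k), pb y)
    (hPa0 : ∀ k, 0 < Pa k) (hPb0 : ∀ k, 0 < Pb k)
    (wa wb : Y → ℝ)
    (hwa : ∀ y, wa y = pa y / Pa (h y)) (hwb : ∀ y, wb y = pb y / Pb (h y))
    (r : Y → ℝ) (ε : Fin K → ℝ)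
    (hε : ∀ k, ε k = (⨆ y : {y : Y // h y = k}, r y.1) -
          ⨅ y : {y : Y // h y = k}, r y.1) :
    |∑ k, Pa k * ∑ y ∈ univ.filter (fun y => h y = k), (wa y - wb y) * r y| ≤
      ⨆ k, ε k := by
  have hPa1 : ∑ k, Pa k = 1 := by
    simp only [hPa, sum_fiberwise, hpa1]
  have cluster (k : Fin K) :
      |∑ y ∈ univ.filter (fun y => h y = k), (wa y - wb y) * r y| ≤ ε k := by
    rw [hε]
    refine abs_sum_sub_mul_le_sub
      (fun y _ => hwa y ▸ div_nonneg (hpa0 y) (hPa0 _).le)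
      (sum_fiber_div_mass_eq_one (hPa k) (hPa0 k).ne' hwa)
      (fun y _ => hwb y ▸ div_nonneg (hpb0 y) (hPb0 _).le)
      (sum_fiber_div_mass_eq_one (hPb k) (hPb0 k).ne' hwb)
      (fun y hy => ?_) (fun y hy => ?_)
    · exact ciInf_le (f := fun y : {y : Y // h y = k} => r y.1)
        (Set.finite_range _).bddBelow ⟨y, (mem_filter.mp hy).2⟩
    · exact le_ciSup (f := fun y : {y : Y // h y = k} => r y.1)
        (Set.finite_range _).bddAbove ⟨y, (mem_filter.mp hy).2⟩
  calc |∑ k, Pa k * ∑ y ∈ univ.filter (fun y => h y = k), (wa y - wb y) * r y|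
      ≤ ∑ k, |Pa k * ∑ y ∈ univ.filter (fun y => h y = k), (wa y - wb y) * r y| :=
        abs_sum_le_sum_abs _ _
    _ ≤ ∑ k, Pa k * ⨆ k, ε k := by
        refine sum_le_sum fun k _ => ?_
        rw [abs_mul, abs_of_pos (hPa0 k)]
        exact mul_le_mul_of_nonneg_left
          ((cluster k).trans (le_ciSup (Set.finite_range ε).bddAbove k)) (hPa0 k).le
    _ = ⨆ k, ε k := by rw [← sum_mul, hPa1, one_mul]
end
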